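/- arXiv:2407.09375 — 2 statements merged into one kernel-verified Lean document; each statement's English description precedes it below -/
import Mathlib

section
/- Let k ≥ 3 and N ≥ 1 be integers, t ∈ ℝ, L ≥ 0, and let u : ℝ → ℝ be k-times continuously differentiable, 1-periodic, with |u^{(k)}(s)| ≤ L for all s ∈ ℝ. Define the truncated derivative estimator u̇_N(t) := −2√2π Σ_{n=1}^{N−1} n·x_n^s(t). Then |u′(t) − u̇_N(t)| ≤ √2 · L · (2π)^{1−k} · Σ_{n=N}^∞ n^{1−k}. -/
open Real

lemma Function.Periodic.deriv_real {g : ℝ → ℝ} {c : ℝ} (hg : Function.Periodic g c) :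
    Function.Periodic (deriv g) c := by
  intro s
  rw [← deriv_comp_add_const]
  congr 1
  exact funext hg

lemma integral_deriv_mul_sin_add_pi_div_two {g : ℝ → ℝ} (hg : ContDiff ℝ 1 g)
    (hper : Function.Periodic g 1) (t φ : ℝ) (n : ℤ) :
    ∫ r in (t - 1)..t, deriv g r * sin (2 * π * n * (t - r) + φ + π / 2) =
      -(2 * π * n) * ∫ r in (t - 1)..t, g r * sin (2 * π * n * (t - r) + φ) := by
  have hg' : Continuous (deriv g) := hg.continuous_deriv le_rfl
  have hgc : Continuous g := hg.continuous
  simp only [sin_add_pi_div_two]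
  have hderiv : ∀ r : ℝ, HasDerivAt (fun r => cos (2 * π * n * (t - r) + φ))
      (2 * π * n * sin (2 * π * n * (t - r) + φ)) r := by
    intro r
    have h := ((((hasDerivAt_id' r).const_sub t).const_mul (2 * π * n)).add_const φ).cos
    convert h using 1
    ring
  have hparts := intervalIntegral.integral_mul_deriv_eq_deriv_mul (a := t - 1) (b := t)
    (u := fun r => cos (2 * π * n * (t - r) + φ)) (v := g)
    (u' := fun r => 2 * π * n * sin (2 * π * n * (t - r) + φ)) (v' := deriv g)
    (fun r _ => hderiv r)
    (fun r _ => (hg.differentiable (by norm_num)).differentiableAt.hasDerivAt)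
    (Continuous.intervalIntegrable (by fun_prop) _ _)
    (hg'.intervalIntegrable _ _)
  have hgt : g (t - 1) = g t := by rw [← hper (t - 1), sub_add_cancel]
  have hcos : cos (2 * π * n * (t - (t - 1)) + φ) = cos (2 * π * n * (t - t) + φ) := by
    rw [← cos_add_int_mul_two_pi (2 * π * n * (t - t) + φ) n]
    congr 1
    ring
  rw [hgt, hcos, sub_self, zero_sub] at hparts
  rw [← intervalIntegral.integral_const_mul]
  simp only [neg_mul, intervalIntegral.integral_neg]
  convert hparts using 1
  · simp only [mul_comm]
  · congr 2
    ext r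
    ring

lemma abs_sin_le_sq (x : ℝ) : |sin x| ≤ √2 / 2 - √2 / 4 * cos (2 * x) := by
  have h2 : √2 * √2 = 2 := mul_self_sqrt (by norm_num)
  have hs : |sin x| ^ 2 = sin x ^ 2 := sq_abs _
  rw [cos_two_mul, cos_sq']
  have hpos : 0 < √2 := by positivity
  nlinarith [mul_nonneg hpos.le (sq_nonneg (√2 * |sin x| - 1))]

lemma integral_abs_sin_le (t φ : ℝ) {n : ℤ} (hn : n ≠ 0) :
    ∫ r in (t - 1)..t, |sin (2 * π * n * (t - r) + φ)| ≤ √2 / 2 := by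
  have hn' : (n : ℝ) ≠ 0 := by exact_mod_cast hn
  have hcos : ∫ r in (t - 1)..t, cos (2 * (2 * π * n * (t - r) + φ)) = 0 := by
    have h := integral_deriv_mul_sin_add_pi_div_two (g := fun _ => (1 : ℝ)) contDiff_const
      (fun _ => rfl) t (2 * φ + π / 2) (2 * n)
    simp only [deriv_const, zero_mul, intervalIntegral.integral_zero, one_mul] at h
    have hne : -(2 * π * ((2 * n : ℤ) : ℝ)) ≠ 0 := by
      push_cast
      simp [pi_ne_zero, hn']
    rw [← (mul_eq_zero.1 h.symm).resolve_left hne]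
    congr 1
    ext r
    rw [← sin_add_pi_div_two]
    push_cast
    congr 1
    ring
  calc ∫ r in (t - 1)..t, |sin (2 * π * n * (t - r) + φ)|
      ≤ ∫ r in (t - 1)..t, (√2 / 2 - √2 / 4 * cos (2 * (2 * π * n * (t - r) + φ))) := by
        apply intervalIntegral.integral_mono_on (by linarith)
        · exact Continuous.intervalIntegrable (by fun_prop) _ _
        · exact Continuous.intervalIntegrable (by fun_prop) _ _
        · exact fun r _ => abs_sin_le_sq _
    _ = √2 / 2 := by
        rw [intervalIntegral.integral_sub (Continuous.intervalIntegrable (by fun_prop) _ _)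
          (Continuous.intervalIntegrable (by fun_prop) _ _),
          intervalIntegral.integral_const_mul, hcos]
        simp

lemma abs_integral_mul_sin_le (m : ℕ) {g : ℝ → ℝ} (hg : ContDiff ℝ m g)
    (hper : Function.Periodic g 1) {M : ℝ} (hM : ∀ s, |iteratedDeriv m g s| ≤ M)
    (t φ : ℝ) {n : ℤ} (hn : n ≠ 0) :
    (2 * π * |(n : ℝ)|) ^ m * |∫ r in (t - 1)..t, g r * sin (2 * π * n * (t - r) + φ)| ≤
      M * (√2 / 2) := by
  induction m generalizing g φ with
  | zero =>
    have hgc : Continuous g := hg.continuous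
    simp only [iteratedDeriv_zero] at hM
    have hM0 : 0 ≤ M := (abs_nonneg _).trans (hM 0)
    rw [pow_zero, one_mul]
    calc |∫ r in (t - 1)..t, g r * sin (2 * π * n * (t - r) + φ)|
        ≤ ∫ r in (t - 1)..t, |g r * sin (2 * π * n * (t - r) + φ)| :=
          intervalIntegral.abs_integral_le_integral_abs (by linarith)
      _ ≤ ∫ r in (t - 1)..t, M * |sin (2 * π * n * (t - r) + φ)| := by
          apply intervalIntegral.integral_mono_on (by linarith)
          · exact Continuous.intervalIntegrable (by fun_prop) _ _
          · exact Continuous.intervalIntegrable (by fun_prop) _ _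
          · intro r _
            rw [abs_mul]
            exact mul_le_mul_of_nonneg_right (hM r) (abs_nonneg _)
      _ ≤ M * (√2 / 2) := by
          rw [intervalIntegral.integral_const_mul]
          exact mul_le_mul_of_nonneg_left (integral_abs_sin_le t φ hn) hM0
  | succ m ih =>
    have hg1 : ContDiff ℝ 1 g := hg.of_le (by exact_mod_cast Nat.le_add_left 1 m)
    have hg' : ContDiff ℝ m (deriv g) := by
      have h : ContDiff ℝ ((m : WithTop ℕ∞) + 1) g := by exact_mod_cast hg
      exact (contDiff_succ_iff_deriv.1 h).2.2
    have h := ih hg' hper.deriv_real (fun s => by simpa only [iteratedDeriv_succ'] using hM s)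
      (φ + π / 2)
    simp only [← add_assoc] at h
    rw [integral_deriv_mul_sin_add_pi_div_two hg1 hper, abs_mul, abs_neg, abs_mul,
      abs_of_pos two_pi_pos] at h
    rwa [pow_succ, mul_assoc]

lemma hasSum_integral_mul_cos {f : ℝ → ℝ} (hper : Function.Periodic f 1)
    {m : ℕ} (hm : 2 ≤ m) (hfm : ContDiff ℝ m f) {M : ℝ} (hM : ∀ s, |iteratedDeriv m f s| ≤ M)
    (t : ℝ) :
    HasSum (fun n : ℤ => ∫ r in (t - 1)..t, f r * sin (2 * π * n * (t - r) + π / 2)) (f t) := by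
  have hfc : Continuous f := hfm.continuous
  have hperC : Function.Periodic (fun s => (f s : ℂ)) 1 := fun s => by simp only [hper s]
  let F : C(UnitAddCircle, ℂ) := ⟨hperC.lift, by
    apply continuous_coinduced_dom.2
    exact Complex.continuous_ofReal.comp hfc⟩
  have hF : ∀ s : ℝ, F (s : UnitAddCircle) = f s := fun s => rfl
  have hcoeff : ∀ n : ℤ, fourierCoeff F n * fourier n (t : UnitAddCircle) =
      ((∫ r in (t - 1)..t, f r * sin (2 * π * n * (t - r) + π / 2) : ℝ) : ℂ) +
        ((∫ r in (t - 1)..t, f r * sin (2 * π * n * (t - r) + 0) : ℝ) : ℂ) * Complex.I := by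
    intro n
    rw [fourierCoeff_eq_intervalIntegral F n (t - 1), sub_add_cancel,
      ← intervalIntegral.integral_ofReal, ← intervalIntegral.integral_ofReal,
      ← intervalIntegral.integral_mul_const, ← intervalIntegral.integral_add
        (Continuous.intervalIntegrable (by fun_prop) _ _)
        (Continuous.intervalIntegrable (by fun_prop) _ _), one_div, inv_one, one_smul,
      ← intervalIntegral.integral_mul_const]
    congr 1
    ext r
    rw [hF, fourier_coe_apply, fourier_coe_apply, smul_eq_mul, mul_right_comm, ← Complex.exp_add,
      sin_add_pi_div_two, add_zero]
    have : 2 * (π : ℂ) * Complex.I * ((-n : ℤ) : ℂ) * r / (1 : ℝ) +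
        2 * (π : ℂ) * Complex.I * n * t / (1 : ℝ) =
        ((2 * π * n * (t - r) : ℝ) : ℂ) * Complex.I := by
      push_cast
      ring
    rw [this, Complex.exp_mul_I]
    push_cast
    ring
  have hsum : Summable (fourierCoeff F) := by
    have hbase : Summable fun n : ℤ => M * √2 * |1 / (n : ℝ) ^ m| :=
      ((summable_one_div_int_pow.2 (by omega : 1 < m)).abs).mul_left _
    refine hbase.of_norm_bounded_eventually ?_
    rw [Filter.eventually_cofinite]
    refine (Set.finite_singleton (0 : ℤ)).subset fun n hn => ?_
    by_contra h0
    apply hn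
    have hn0 : n ≠ 0 := h0
    have hnp : 0 < |(n : ℝ)| := abs_pos.2 (by exact_mod_cast hn0)
    have hb : ∀ φ : ℝ, |∫ r in (t - 1)..t, f r * sin (2 * π * n * (t - r) + φ)| ≤
        M * (√2 / 2) * |1 / (n : ℝ) ^ m| := by
      intro φ
      have h := abs_integral_mul_sin_le m hfm hper hM t φ hn0
      rw [abs_div, abs_one, abs_pow, mul_one_div, le_div_iff₀ (by positivity), mul_comm]
      refine le_trans ?_ h
      gcongr
      nlinarith [pi_gt_three]
    have hnorm : ‖fourierCoeff F n‖ = ‖fourierCoeff F n * fourier n (t : UnitAddCircle)‖ := by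
      rw [norm_mul, fourier_apply, Circle.norm_coe, mul_one]
    rw [hnorm, hcoeff]
    refine (norm_add_le _ _).trans ?_
    rw [norm_mul, Complex.norm_I, mul_one, Complex.norm_real, Complex.norm_real,
      norm_eq_abs, norm_eq_abs]
    linarith [hb (π / 2), hb 0]
  have h := has_pointwise_sum_fourier_series_of_summable hsum (t : UnitAddCircle)
  simp only [smul_eq_mul, hcoeff, hF] at h
  simpa using Complex.hasSum_re h

/-- Main inequality in the approximation-error theorem: for `k ≥ 3`, `N ≥ 1`, `u`
`k`-times continuously differentiable, 1-periodic with `|u^{(k)}| ≤ L`, the truncated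
derivative estimator `u̇_N(t) = −2√2π Σ_{n=1}^{N−1} n·x_n^s(t)` satisfies
`|u'(t) − u̇_N(t)| ≤ √2 · L · (2π)^{1−k} · Σ_{n=N}^∞ n^{1−k}`, where
`x_n^s(t) = √2 ∫_{t-1}^t u(r) sin(2πn(t-r)) dr`. -/
theorem stmt_9 (k N : ℕ) (hk : 3 ≤ k) (hN : 1 ≤ N) (t : ℝ) (L : ℝ) (hL : 0 ≤ L)
    (u : ℝ → ℝ) (hu : ContDiff ℝ k u) (hper : ∀ s : ℝ, u (s + 1) = u s)
    (hbound : ∀ s : ℝ, |iteratedDeriv k u s| ≤ L) :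
    |deriv u t -
        (-(2 * Real.sqrt 2 * π) *
          ∑ n ∈ Finset.range N,
            (n : ℝ) * (Real.sqrt 2 * ∫ r in (t - 1)..t, u r * Real.sin (2 * π * n * (t - r))))| ≤
      Real.sqrt 2 * L * (2 * π) ^ ((1 : ℤ) - k) * ∑' n : ℕ, ((N + n : ℕ) : ℝ) ^ ((1 : ℤ) - k) := by
  obtain ⟨m, rfl⟩ : ∃ m, k = m + 1 := ⟨k - 1, by omega⟩
  have hm : 2 ≤ m := by omega
  have hexp : (1 : ℤ) - ((m + 1 : ℕ) : ℤ) = -(m : ℤ) := by push_cast; ring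
  simp only [hexp, zpow_neg, zpow_natCast]
  have hperu : Function.Periodic u 1 := hper
  have hu1 : ContDiff ℝ 1 u := hu.of_le (by exact_mod_cast Nat.le_add_left 1 m)
  have hu' : ContDiff ℝ m (deriv u) := by
    have h : ContDiff ℝ ((m : WithTop ℕ∞) + 1) u := by exact_mod_cast hu
    exact (contDiff_succ_iff_deriv.1 h).2.2
  have hM : ∀ s, |iteratedDeriv m (deriv u) s| ≤ L := fun s => by
    simpa only [iteratedDeriv_succ'] using hbound s
  set a : ℤ → ℝ := fun n => ∫ r in (t - 1)..t, deriv u r * sin (2 * π * n * (t - r) + π / 2)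
    with ha
  have ha_eq : ∀ n : ℤ, a n = -(2 * π * n) * ∫ r in (t - 1)..t, u r * sin (2 * π * n * (t - r)) := by
    intro n
    simpa using integral_deriv_mul_sin_add_pi_div_two hu1 hperu t 0 n
  have ha_neg : ∀ n : ℤ, a (-n) = a n := by
    intro n
    simp only [ha, sin_add_pi_div_two]
    congr 1
    ext r
    rw [← cos_neg]
    push_cast
    congr 2
    ring
  have ha_zero : a 0 = 0 := by simp [ha_eq]
  have hsum : HasSum (fun n : ℕ => 2 * a n) (deriv u t) := by
    have h := (hasSum_integral_mul_cos hperu.deriv_real hm hu' hM t).nat_add_neg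
    change HasSum (fun n : ℕ => a n + a (-n)) (deriv u t + a 0) at h
    simpa only [ha_neg, ha_zero, add_zero, ← two_mul] using h
  have hest : -(2 * √2 * π) * ∑ n ∈ Finset.range N,
      (n : ℝ) * (√2 * ∫ r in (t - 1)..t, u r * sin (2 * π * n * (t - r))) =
      ∑ n ∈ Finset.range N, 2 * a n := by
    rw [Finset.mul_sum]
    refine Finset.sum_congr rfl fun n _ => ?_
    have h2 : √2 * √2 = 2 := mul_self_sqrt (by norm_num)
    rw [ha_eq, Int.cast_natCast]
    linear_combination
      (-(2 * π * n) * ∫ r in (t - 1)..t, u r * sin (2 * π * n * (t - r))) * h2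
  have htail : HasSum (fun n : ℕ => 2 * a ((N + n : ℕ) : ℤ))
      (deriv u t - ∑ n ∈ Finset.range N, 2 * a n) := by
    have h := (hasSum_nat_add_iff' N).2 hsum
    simpa only [add_comm] using h
  have hterm : ∀ n : ℕ, ‖2 * a ((N + n : ℕ) : ℤ)‖ ≤
      √2 * L * ((2 * π) ^ m)⁻¹ * (((N + n : ℕ) : ℝ) ^ m)⁻¹ := by
    intro n
    have h := abs_integral_mul_sin_le m hu' hperu.deriv_real hM t (π / 2)
      (n := ((N + n : ℕ) : ℤ)) (by omega)
    have hpos : (0 : ℝ) < ((N + n : ℕ) : ℝ) := by exact_mod_cast (by omega : 0 < N + n)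
    change _ * |a ((N + n : ℕ) : ℤ)| ≤ _ at h
    rw [Int.cast_natCast, abs_of_pos hpos, mul_pow] at h
    rw [norm_mul, norm_two, norm_eq_abs, mul_assoc, ← mul_inv, ← div_eq_mul_inv,
      le_div_iff₀ (by positivity)]
    linarith
  have hmaj : Summable fun n : ℕ => (((N + n : ℕ) : ℝ) ^ m)⁻¹ := by
    have h := (summable_nat_add_iff N).2 (summable_nat_pow_inv.2 (by omega : 1 < m))
    simpa only [add_comm] using h
  rw [hest, ← norm_eq_abs, ← htail.tsum_eq, ← tsum_mul_left]
  exact tsum_of_norm_bounded (hmaj.mul_left _).hasSum hterm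
end

section
/- For every integer k ≥ 3 there exists a constant C > 0, depending only on k, such that for all t ∈ ℝ, L ≥ 0, integers N ≥ 1, and every k-times continuously differentiable 1-periodic function u : ℝ → ℝ with |u^{(k)}(s)| ≤ L for all s ∈ ℝ, the truncated derivative estimator u̇_N(t) := −2√2π Σ_{n=1}^{N−1} n·x_n^s(t) satisfies |u′(t) − u̇_N(t)| ≤ C · L / N^{k−2}. -/
open Real

open Filter Topology intervalIntegral

/-- The Fourier mode at `t` of index `n` of `f`, computed over the window `[t - 1, t]`. -/
noncomputable def windowMode (t : ℝ) (f : ℝ → ℝ) (n : ℤ) : ℂ :=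
  ∫ r in (t - 1)..t, Complex.exp (2 * π * Complex.I * n * (t - r)) * (f r : ℂ)

lemma norm_windowMode_kernel (n : ℤ) (t r : ℝ) :
    ‖Complex.exp (2 * π * Complex.I * n * (t - r))‖ = 1 := by
  rw [show (2 * π * Complex.I * n * (t - r) : ℂ) = ((2 * π * n * (t - r) : ℝ) : ℂ) * Complex.I by
    push_cast; ring]
  exact Complex.norm_exp_ofReal_mul_I _

lemma norm_windowMode_le {f : ℝ → ℝ} {L : ℝ} (hf : ∀ s, |f s| ≤ L) (t : ℝ) (n : ℤ) :
    ‖windowMode t f n‖ ≤ L := by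
  have := norm_integral_le_of_norm_le_const (a := t - 1) (b := t) (C := L)
    (f := fun r : ℝ => Complex.exp (2 * π * Complex.I * n * (t - r)) * (f r : ℂ))
    (fun r _ => by
      rw [norm_mul, norm_windowMode_kernel, one_mul, Complex.norm_real]
      exact hf r)
  simpa [windowMode] using this

lemma windowMode_deriv {f : ℝ → ℝ} (hf : ContDiff ℝ 1 f) (hper : Function.Periodic f 1)
    (t : ℝ) (n : ℤ) :
    windowMode t (deriv f) n = 2 * π * Complex.I * n * windowMode t f n := by
  have hexp : ∀ r : ℝ, HasDerivAt
      (fun r : ℝ => Complex.exp (2 * π * Complex.I * n * (t - r)))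
      (-(2 * π * Complex.I * n) * Complex.exp (2 * π * Complex.I * n * (t - r))) r := by
    intro r
    have h := ((((Complex.ofRealCLM.hasDerivAt (x := r)).const_sub (t : ℂ)).const_mul
      (2 * π * Complex.I * n : ℂ))).cexp
    simp only [Complex.ofRealCLM_apply, Complex.ofReal_one] at h
    convert h using 1
    ring
  have hder : ∀ r : ℝ, HasDerivAt (fun r : ℝ => (f r : ℂ)) ((deriv f r : ℝ) : ℂ) r := fun r =>
    ((hf.differentiable one_ne_zero) r).hasDerivAt.ofReal_comp
  have hcont : Continuous (deriv f) := hf.continuous_deriv le_rfl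
  have hparts := integral_mul_deriv_eq_deriv_mul (a := t - 1) (b := t)
    (fun r _ => hexp r) (fun r _ => hder r)
    (Continuous.intervalIntegrable (by fun_prop) _ _)
    (Continuous.intervalIntegrable (by fun_prop) _ _)
  have hend : Complex.exp (2 * π * Complex.I * n * (t - (t - 1 : ℝ))) = 1 := by
    rw [← Complex.exp_int_mul_two_pi_mul_I n]
    congr 1
    push_cast
    ring
  have hft : f (t - 1) = f t := hper.sub_eq t
  rw [hend, hft] at hparts
  simp only [sub_self, mul_zero, Complex.exp_zero, one_mul, zero_sub, mul_assoc] at hparts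
  simp only [windowMode]
  simp only [mul_assoc]
  rw [hparts, ← integral_neg]
  simp only [← integral_const_mul]
  congr 1
  ext r
  ring

lemma periodic_iteratedDeriv {f : ℝ → ℝ} {c : ℝ} (hf : Function.Periodic f c) (m : ℕ) :
    Function.Periodic (iteratedDeriv m f) c := by
  induction m with
  | zero => simpa using hf
  | succ m ih =>
    intro x
    rw [iteratedDeriv_succ, ← deriv_comp_add_const]
    congr 1
    exact funext ih

lemma windowMode_iteratedDeriv {f : ℝ → ℝ} {k : ℕ} (hf : ContDiff ℝ k f)
    (hper : Function.Periodic f 1) (t : ℝ) (n : ℤ) {m : ℕ} (hm : m ≤ k) :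
    windowMode t (iteratedDeriv m f) n = (2 * π * Complex.I * n) ^ m * windowMode t f n := by
  induction m with
  | zero => simp
  | succ m ih =>
    have hC : ContDiff ℝ 1 (iteratedDeriv m f) := by
      rw [iteratedDeriv_eq_iterate]
      exact ContDiff.iterate_deriv' 1 m (hf.of_le (by exact_mod_cast (by omega : 1 + m ≤ k)))
    rw [iteratedDeriv_succ, windowMode_deriv hC (periodic_iteratedDeriv hper m),
      ih (by omega), pow_succ]
    ring

lemma norm_windowMode_deriv_le {f : ℝ → ℝ} {k : ℕ} (hk : 1 ≤ k) (hf : ContDiff ℝ k f)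
    (hper : Function.Periodic f 1) {L : ℝ} (hL : ∀ s, |iteratedDeriv k f s| ≤ L)
    (t : ℝ) (n : ℤ) :
    ‖windowMode t (deriv f) n‖ ≤ L / |(n : ℝ)| ^ (k - 1) := by
  have hL0 : 0 ≤ L := (abs_nonneg _).trans (hL 0)
  have h1 : windowMode t (deriv f) n = 2 * π * Complex.I * n * windowMode t f n := by
    simpa using windowMode_iteratedDeriv hf hper t n hk
  rcases eq_or_ne n 0 with rfl | hn
  · rw [h1]
    simp only [Int.cast_zero, mul_zero, zero_mul, norm_zero]
    positivity
  have hk' := windowMode_iteratedDeriv hf hper t n le_rfl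
  obtain ⟨j, rfl⟩ : ∃ j, k = j + 1 := ⟨k - 1, by omega⟩
  rw [pow_succ, mul_assoc, ← h1] at hk'
  have hle := norm_windowMode_le hL t n
  have hnpos : 0 < |(n : ℝ)| := abs_pos.2 (by exact_mod_cast hn)
  rw [hk', norm_mul, norm_pow] at hle
  have hnorm : |(n : ℝ)| ≤ ‖(2 * π * Complex.I * n : ℂ)‖ := by
    simp only [norm_mul, Complex.norm_I, Complex.norm_real, Complex.norm_intCast,
      Complex.norm_ofNat, Real.norm_eq_abs, abs_of_pos pi_pos, mul_one]
    nlinarith [pi_gt_three]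
  rw [Nat.add_sub_cancel, le_div_iff₀ (by positivity), mul_comm]
  exact (mul_le_mul_of_nonneg_right (pow_le_pow_left₀ hnpos.le hnorm j) (norm_nonneg _)).trans hle

lemma hasSum_windowMode {f : ℝ → ℝ} (hf : Continuous f) (hper : Function.Periodic f 1) (t : ℝ)
    (hs : Summable fun n : ℤ => windowMode t f n) :
    HasSum (fun n : ℤ => windowMode t f n) (f t : ℂ) := by
  have hper' : Function.Periodic (fun r => (f r : ℂ)) 1 := fun r => by simp [hper r]
  let F : C(UnitAddCircle, ℂ) :=
    ⟨hper'.lift, continuous_quot_lift _ (Complex.continuous_ofReal.comp hf)⟩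
  have hcoe : ∀ r : ℝ, F (r : UnitAddCircle) = (f r : ℂ) := fun r => rfl
  have hmode : ∀ n : ℤ, fourierCoeff F n • fourier n (t : UnitAddCircle) = windowMode t f n := by
    intro n
    rw [fourierCoeff_eq_intervalIntegral _ _ (t - 1), windowMode, smul_eq_mul, mul_comm]
    simp only [sub_add_cancel, div_one, one_smul, smul_eq_mul, hcoe]
    rw [← integral_const_mul]
    congr 1
    ext r
    rw [← mul_assoc, fourier_coe_apply, fourier_coe_apply, ← Complex.exp_add]
    congr 2
    push_cast
    ring
  have hsum : Summable (fourierCoeff F) := by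
    rw [← summable_norm_iff] at hs ⊢
    refine hs.congr fun n => ?_
    rw [← hmode, norm_smul, fourier_apply, Circle.norm_coe, mul_one]
  have := has_pointwise_sum_fourier_series_of_summable hsum (t : UnitAddCircle)
  simpa only [hmode, hcoe] using this

lemma windowMode_deriv_add_neg {f : ℝ → ℝ} (hf : ContDiff ℝ 1 f)
    (hper : Function.Periodic f 1) (t : ℝ) (n : ℕ) :
    windowMode t (deriv f) n + windowMode t (deriv f) (-n) =
      ((-(4 * π) * (n * ∫ r in (t - 1)..t, f r * Real.sin (2 * π * n * (t - r))) : ℝ) : ℂ) := by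
  have hc := hf.continuous
  rw [windowMode_deriv hf hper, windowMode_deriv hf hper]
  simp only [windowMode]
  push_cast
  rw [← integral_ofReal]
  simp only [← integral_const_mul]
  rw [← integral_add (Continuous.intervalIntegrable (by fun_prop) _ _)
    (Continuous.intervalIntegrable (by fun_prop) _ _)]
  congr 1
  ext r
  push_cast
  rw [Complex.sin]
  rw [show (2 * π * Complex.I * n * (t - r) : ℂ) = 2 * π * n * (t - r) * Complex.I by ring,
    show (2 * π * Complex.I * -n * (t - r) : ℂ) = -(2 * π * n * (t - r)) * Complex.I by ring]
  ring

lemma hasSum_one_div_sub_one_div_succ {N : ℕ} (hN : 1 ≤ N) :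
    HasSum (fun n : ℕ => 1 / ((n + N : ℕ) : ℝ) - 1 / ((n + 1 + N : ℕ) : ℝ)) (1 / (N : ℝ)) := by
  rw [hasSum_iff_tendsto_nat_of_nonneg]
  · simp_rw [Finset.sum_range_sub' (fun n : ℕ => 1 / ((n + N : ℕ) : ℝ))]
    have h := ((tendsto_add_atTop_iff_nat N).2
      (tendsto_one_div_atTop_nhds_zero_nat (𝕜 := ℝ))).const_sub (1 / (N : ℝ))
    simpa using h
  · intro n
    rw [sub_nonneg]
    refine one_div_le_one_div_of_le (by exact_mod_cast (by omega : 0 < n + N)) ?_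
    exact_mod_cast (by omega : n + N ≤ n + 1 + N)

/-- Approximation-error theorem: for every `k ≥ 3` there is a constant `C > 0`,
depending only on `k`, such that for all `t`, `L ≥ 0`, `N ≥ 1`, and every `k`-times
continuously differentiable 1-periodic `u` with `|u^{(k)}| ≤ L`, the truncated
derivative estimator `u̇_N(t) = −2√2π Σ_{n=1}^{N−1} n·x_n^s(t)` satisfies
`|u'(t) − u̇_N(t)| ≤ C · L / N^{k−2}`, where
`x_n^s(t) = √2 ∫_{t-1}^t u(r) sin(2πn(t-r)) dr`. -/
theorem stmt_10 (k : ℕ) (hk : 3 ≤ k) :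
    ∃ C : ℝ, 0 < C ∧
      ∀ (t L : ℝ), 0 ≤ L → ∀ N : ℕ, 1 ≤ N → ∀ u : ℝ → ℝ,
        ContDiff ℝ k u → (∀ s : ℝ, u (s + 1) = u s) →
        (∀ s : ℝ, |iteratedDeriv k u s| ≤ L) →
        |deriv u t -
            (-(2 * Real.sqrt 2 * π) *
              ∑ n ∈ Finset.range N,
                (n : ℝ) *
                  (Real.sqrt 2 * ∫ r in (t - 1)..t, u r * Real.sin (2 * π * n * (t - r))))| ≤
          C * L / (N : ℝ) ^ (k - 2) := by
  refine ⟨4, by norm_num, ?_⟩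
  intro t L hL N hN u hu hper hbound
  have hu1 : ContDiff ℝ 1 u := hu.of_le (by exact_mod_cast (by omega : 1 ≤ k))
  have hmode := norm_windowMode_deriv_le (by omega) hu hper hbound t
  have hdper : Function.Periodic (deriv u) 1 := by
    simpa using periodic_iteratedDeriv hper 1
  have hsummable : Summable fun n : ℤ => windowMode t (deriv u) n := by
    refine Summable.of_norm_bounded
      (((Real.summable_one_div_int_pow (p := k - 1)).2 (by omega)).abs.mul_left L) fun n => ?_
    simpa [div_eq_mul_inv] using hmode n
  have hzero : windowMode t (deriv u) 0 = 0 := by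
    rw [windowMode_deriv hu1 hper]
    simp
  have hsum := (hasSum_windowMode (hu1.continuous_deriv le_rfl) hdper t hsummable).nat_add_neg
  rw [hzero, add_zero] at hsum
  set g : ℕ → ℝ := fun n =>
    -(4 * π) * (n * ∫ r in (t - 1)..t, u r * Real.sin (2 * π * n * (t - r))) with hg
  have hgmode : ∀ n : ℕ,
      windowMode t (deriv u) n + windowMode t (deriv u) (-n) = (g n : ℂ) :=
    windowMode_deriv_add_neg hu1 hper t
  simp only [hgmode] at hsum
  have htail := (hasSum_nat_add_iff' N).2 (Complex.hasSum_ofReal.1 hsum)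
  have hgoal : -(2 * Real.sqrt 2 * π) * ∑ n ∈ Finset.range N, (n : ℝ) *
      (Real.sqrt 2 * ∫ r in (t - 1)..t, u r * Real.sin (2 * π * n * (t - r))) =
      ∑ n ∈ Finset.range N, g n := by
    rw [Finset.mul_sum]
    refine Finset.sum_congr rfl fun n _ => ?_
    have h2 : Real.sqrt 2 * Real.sqrt 2 = 2 := Real.mul_self_sqrt (by norm_num)
    rw [hg]
    linear_combination (-2 * π * n *
      ∫ r in (t - 1)..t, u r * Real.sin (2 * π * n * (t - r))) * h2
  rw [hgoal]
  have hNpos : (0 : ℝ) < N := by exact_mod_cast hN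
  have hterm : ∀ n : ℕ, ‖g (n + N)‖ ≤ 4 * L / (N : ℝ) ^ (k - 3) *
      (1 / ((n + N : ℕ) : ℝ) - 1 / ((n + 1 + N : ℕ) : ℝ)) := by
    intro n
    have hgle : ‖g (n + N)‖ ≤ 2 * (L / ((n + N : ℕ) : ℝ) ^ (k - 1)) := by
      have h1 := hmode ((n + N : ℕ) : ℤ)
      have h2 := hmode (-((n + N : ℕ) : ℤ))
      rw [Int.cast_neg, abs_neg] at h2
      rw [Int.cast_natCast, Nat.abs_cast] at h1 h2
      rw [← Complex.norm_real, ← hgmode]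
      linarith [norm_add_le (windowMode t (deriv u) ((n + N : ℕ) : ℤ))
        (windowMode t (deriv u) (-((n + N : ℕ) : ℤ)))]
    refine hgle.trans ?_
    rw [show ((n + 1 + N : ℕ) : ℝ) = ((n + N : ℕ) : ℝ) + 1 by push_cast; ring,
      show k - 1 = (k - 3) + 2 by omega]
    have hxN : (N : ℝ) ≤ ((n + N : ℕ) : ℝ) := by exact_mod_cast (by omega : N ≤ n + N)
    have hx1 : (1 : ℝ) ≤ ((n + N : ℕ) : ℝ) := by exact_mod_cast (by omega : 1 ≤ n + N)
    generalize ((n + N : ℕ) : ℝ) = x at hxN hx1 ⊢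
    have hx0 : 0 < x := by linarith
    have hpow : (N : ℝ) ^ (k - 3) ≤ x ^ (k - 3) := pow_le_pow_left₀ hNpos.le hxN _
    have hsq : 1 / x ^ 2 ≤ 2 * (1 / x - 1 / (x + 1)) := by
      rw [show 2 * (1 / x - 1 / (x + 1)) = 2 / (x * (x + 1)) by field_simp; ring,
        div_le_div_iff₀ (by positivity) (by positivity)]
      nlinarith
    calc 2 * (L / x ^ (k - 3 + 2)) = 2 * L / x ^ (k - 3) * (1 / x ^ 2) := by
          rw [pow_add]; field_simp
      _ ≤ 2 * L / (N : ℝ) ^ (k - 3) * (2 * (1 / x - 1 / (x + 1))) := by gcongr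
      _ = _ := by ring
  have hfinal := htail.norm_le_of_bounded
    ((hasSum_one_div_sub_one_div_succ hN).mul_left (4 * L / (N : ℝ) ^ (k - 3))) hterm
  rw [Real.norm_eq_abs] at hfinal
  refine hfinal.trans_eq ?_
  rw [show k - 2 = (k - 3) + 1 by omega, pow_succ]
  field_simp
end
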